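/- arXiv:2310.02607 — 2 statements merged into one kernel-verified Lean document; each statement's English description precedes it below -/
import Mathlib

section
/- For every integer m with 1 ≤ m ≤ n_γ and every ν ≥ 0, the function φ_m(x) = p_m(x)(x_{1,m}/(x_{1,m} − x))^{1/2} satisfies sup_{x ∈ [0, x_{1,m}]} x^ν φ_m(x)² ≤ ν^ν |p_m′(0)|^{-ν} (with the convention 0⁰ = 1 for ν = 0). -/
open scoped RealInnerProductSpace BigOperators Classical
open Polynomial

noncomputable section

/-- The semi-inner product `[p,q]_(l)` associated with the measure
`μ_n^(l) = ∑ i, ξ i ^ l * w i * δ_{ξ i}`, where `w i = ⟪e i, r⟫² `. -/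
def cgIP {ι : Type*} [Fintype ι] (ξ w : ι → ℝ) (l : ℕ) (p q : Polynomial ℝ) : ℝ :=
  ∑ i, (ξ i) ^ l * w i * p.eval (ξ i) * q.eval (ξ i)

/-- The cardinality `n_γ` of the support of the measure `μ_n^(0)`. -/
def cgNGamma {ι : Type*} [Fintype ι] (ξ w : ι → ℝ) : ℕ :=
  ((Finset.univ.filter (fun i => w i ≠ 0)).image ξ).card

/-- The first-order optimality condition for the residual polynomial: `p` is orthogonal, for the
weight of order one, to every polynomial of smaller degree. -/
theorem cgIP_one_eq_zero_of_minimal {ι : Type*} [Fintype ι] {ξ w : ι → ℝ} (hw : ∀ i, 0 ≤ w i)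
    {m : ℕ} {p : ℝ[X]} (hdeg : p.natDegree ≤ m) (hconst : p.eval 0 = 1)
    (hmin : ∀ q : ℝ[X], q.natDegree ≤ m → q.eval 0 = 1 → cgIP ξ w 0 p p ≤ cgIP ξ w 0 q q)
    {q : ℝ[X]} (hq : q.natDegree + 1 ≤ m) : cgIP ξ w 1 p q = 0 := by
  set A : ℝ := cgIP ξ w 2 q q with hA
  set B : ℝ := cgIP ξ w 1 p q with hB
  have hA0 : 0 ≤ A := Finset.sum_nonneg fun i _ => by
    have := mul_nonneg (hw i) (sq_nonneg (ξ i * q.eval (ξ i)))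
    nlinarith
  have expand (t : ℝ) : cgIP ξ w 0 (p + C t * (X * q)) (p + C t * (X * q)) =
      cgIP ξ w 0 p p + 2 * t * B + t ^ 2 * A := by
    simp only [hA, hB, cgIP, Finset.mul_sum, ← Finset.sum_add_distrib]
    refine Finset.sum_congr rfl fun i _ => ?_
    simp only [eval_add, eval_mul, eval_C, eval_X]
    ring
  have nonneg (t : ℝ) : 0 ≤ 2 * t * B + t ^ 2 * A := by
    have hdeg' : (p + C t * (X * q)).natDegree ≤ m := by
      refine natDegree_add_le_of_degree_le hdeg ((natDegree_C_mul_le _ _).trans ?_)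
      refine natDegree_mul_le.trans ?_
      rw [natDegree_X]
      omega
    have := hmin _ hdeg' (by simp [hconst])
    rw [expand] at this
    linarith
  have key := nonneg (-B / (A + 1))
  have hpos : 0 < A + 1 := by linarith
  have heq : 2 * (-B / (A + 1)) * B + (-B / (A + 1)) ^ 2 * A =
      -(B ^ 2 * (A + 2)) / (A + 1) ^ 2 := by
    field_simp
    ring
  rw [heq, le_div_iff₀ (by positivity)] at key
  have : B ^ 2 ≤ 0 := by nlinarith [sq_nonneg B, mul_nonneg (sq_nonneg B) hA0]
  exact pow_eq_zero_iff two_ne_zero |>.1 (le_antisymm this (sq_nonneg B))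

/-- A real polynomial without real roots has constant sign. -/
theorem eval_mul_eval_pos_of_eval_ne_zero {f : ℝ[X]} (hf : ∀ x, f.eval x ≠ 0) (a b : ℝ) :
    0 < f.eval a * f.eval b := by
  by_contra! h
  have hmem : (0 : ℝ) ∈ Set.uIcc (f.eval a) (f.eval b) := by
    rw [Set.mem_uIcc]
    rcases mul_nonpos_iff.1 h with ⟨h₁, h₂⟩ | ⟨h₁, h₂⟩
    · exact Or.inr ⟨h₂, h₁⟩
    · exact Or.inl ⟨h₁, h₂⟩
  obtain ⟨x, -, hx⟩ := intermediate_value_uIcc f.continuous.continuousOn hmem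
  exact hf x hx

/-- The residual polynomial has only real roots. -/
theorem splits_of_minimal {ι : Type*} [Fintype ι] {ξ w : ι → ℝ} (hw : ∀ i, 0 ≤ w i)
    (hξ : ∀ i, 0 ≤ ξ i) {m : ℕ} (hmγ : m ≤ cgNGamma ξ w)
    {p : ℝ[X]} (hdeg : p.natDegree ≤ m) (hconst : p.eval 0 = 1)
    (hmin : ∀ q : ℝ[X], q.natDegree ≤ m → q.eval 0 = 1 → cgIP ξ w 0 p p ≤ cgIP ξ w 0 q q) :
    p.Splits := by
  have hp0 : p ≠ 0 := by
    rintro rfl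
    simp at hconst
  obtain ⟨f, hpf, hcard, hfroots⟩ := exists_prod_multiset_X_sub_C_mul p
  by_cases hf1 : f.natDegree ≤ 1
  · have hf0 := (Splits.of_natDegree_le_one hf1).natDegree_eq_card_roots
    rw [hfroots, Multiset.card_zero] at hf0
    rw [splits_iff_card_roots]
    omega
  exfalso
  set g : ℝ[X] := (p.roots.map fun a => X - C a).prod
  have hgdeg : g.natDegree = p.roots.card := natDegree_multiset_prod_X_sub_C_eq_card _
  have hf0 : f ≠ 0 := by
    rintro rfl
    simp at hf1
  have hfne (x : ℝ) : f.eval x ≠ 0 := fun hx => by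
    have := (mem_roots hf0).2 hx
    simp [hfroots] at this
  have hg0 : g ≠ 0 := by
    intro h
    rw [h, zero_mul] at hpf
    exact hp0 hpf.symm
  have horth := cgIP_one_eq_zero_of_minimal hw hdeg hconst hmin (q := g) (by omega)
  have hsum : ∑ i, ξ i * w i * g.eval (ξ i) ^ 2 * (f.eval 0 * f.eval (ξ i)) = 0 := by
    refine Eq.trans ?_ (mul_eq_zero_of_right (f.eval 0) horth)
    rw [cgIP, Finset.mul_sum]
    refine Finset.sum_congr rfl fun i _ => ?_
    rw [← hpf, eval_mul]
    ring
  rw [Finset.sum_eq_zero_iff_of_nonneg fun i _ => by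
    have := eval_mul_eval_pos_of_eval_ne_zero hfne 0 (ξ i)
    have := hw i
    have := hξ i
    positivity] at hsum
  set S := (Finset.univ.filter fun i => w i ≠ 0).image ξ with hS
  have hsub : (S.erase 0).val ⊆ g.roots := fun x hx => by
    rw [Finset.mem_val, Finset.mem_erase, hS, Finset.mem_image] at hx
    obtain ⟨hx0, i, hi, rfl⟩ := hx
    have hwi : w i ≠ 0 := (Finset.mem_filter.1 hi).2
    rw [mem_roots hg0, IsRoot]
    have := hsum i (Finset.mem_univ i)
    simpa [hx0, hwi, hfne] using this
  have h₁ := card_le_degree_of_subset_roots hsub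
  have h₂ := Finset.pred_card_le_card_erase (s := S) (a := 0)
  have h₃ : m ≤ S.card := hmγ
  omega

/-- A split polynomial with constant term one is the product of the factors `1 - r⁻¹ X` over
its roots `r`. -/
theorem Polynomial.Splits.eq_prod_one_sub_inv_mul_X {p : ℝ[X]} (hp : p.Splits)
    (hconst : p.eval 0 = 1) : p = (p.roots.map fun r => 1 - C r⁻¹ * X).prod := by
  have hp0 : p ≠ 0 := by
    rintro rfl
    simp at hconst
  have hne : ∀ r ∈ p.roots, r ≠ 0 := by
    rintro r hr rfl
    rw [mem_roots hp0, IsRoot, hconst] at hr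
    exact one_ne_zero hr
  have hfac : (p.roots.map fun r => X - C r).prod =
      C (p.roots.map fun r => -r).prod * (p.roots.map fun r => 1 - C r⁻¹ * X).prod := by
    rw [map_multiset_prod, Multiset.map_map, ← Multiset.prod_map_mul]
    refine congrArg _ (Multiset.map_congr rfl fun r hr => ?_)
    have : C r * C r⁻¹ = (1 : ℝ[X]) := by rw [← C_mul, mul_inv_cancel₀ (hne r hr), C_1]
    simp only [Function.comp_apply, C_neg]
    linear_combination (-X) * this
  have hone : p.leadingCoeff * (p.roots.map fun r => -r).prod = 1 := by
    rw [← hconst, hp.eval_eq_prod_roots]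
    simp
  conv_lhs => rw [hp.eq_prod_roots, hfac, ← mul_assoc, ← C_mul, hone, C_1, one_mul]

/-- A product of factors `1 - r⁻¹ X` with positive `r` is bounded, left of the smallest `r`, by the
exponential with the same slope at the origin. -/
theorem eval_prod_one_sub_inv_mul_X_le_exp {a x : ℝ} (ha : 0 < a) (hx : x ∈ Set.Icc 0 a)
    (s : Multiset ℝ) (hs : ∀ r ∈ s, a ≤ r) :
    let g : ℝ[X] := (s.map fun r => 1 - C r⁻¹ * X).prod
    g.eval 0 = 1 ∧ g.derivative.eval 0 ≤ 0 ∧ 0 ≤ g.eval x ∧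
      g.eval x ≤ Real.exp (x * g.derivative.eval 0) := by
  induction s using Multiset.induction_on with
  | empty => simp
  | cons r s ih =>
    obtain ⟨h₀, hd, hnn, hle⟩ := ih fun r hr => hs r (Multiset.mem_cons_of_mem hr)
    have har : a ≤ r := hs r (Multiset.mem_cons_self r s)
    have hr : 0 < r := ha.trans_le har
    have hxr : 0 ≤ 1 - r⁻¹ * x := by
      rw [sub_nonneg, inv_mul_le_iff₀ hr, mul_one]
      exact hx.2.trans har
    have hexp : 1 - r⁻¹ * x ≤ Real.exp (x * -r⁻¹) := by
      have := Real.add_one_le_exp (x * -r⁻¹)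
      linarith
    simp only [Multiset.map_cons, Multiset.prod_cons, derivative_mul, eval_add, eval_mul,
      eval_sub, eval_one, eval_C, eval_X, derivative_sub, derivative_one, derivative_C,
      derivative_X, eval_zero, h₀]
    refine ⟨by ring, ?_, mul_nonneg hxr hnn, ?_⟩
    · have := inv_pos.2 hr
      linarith
    · calc _ ≤ Real.exp (x * -r⁻¹) * Real.exp (x * _) := mul_le_mul hexp hle hnn (Real.exp_nonneg _)
        _ = _ := by rw [← Real.exp_add]; congr 1; ring

theorem rpow_mul_exp_neg_le {x s ν : ℝ} (hx : 0 ≤ x) (hs : 0 < s) (hν : 0 ≤ ν) :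
    x ^ ν * Real.exp (-(x * s)) ≤ ν ^ ν * s ^ (-ν) := by
  rcases hν.eq_or_lt with rfl | hν
  · simpa using mul_nonneg hx hs.le
  have hle : x * s / ν ≤ Real.exp (x * s / ν) := by
    have := Real.add_one_le_exp (x * s / ν)
    linarith
  have hpow := Real.rpow_le_rpow (by positivity) hle hν.le
  rw [← Real.exp_mul, div_mul_cancel₀ _ hν.ne', Real.div_rpow (by positivity) hν.le,
    Real.mul_rpow hx hs.le, div_le_iff₀ (by positivity)] at hpow
  rw [Real.exp_neg, Real.rpow_neg hs.le, ← div_eq_mul_inv, ← div_eq_mul_inv,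
    div_le_div_iff₀ (Real.exp_pos _) (by positivity)]
  linarith

/-- for `1 ≤ m ≤ n_γ` and `ν ≥ 0`, the function
`φ_m(x) = p_m(x) √(x_{1,m}/(x_{1,m}-x))` satisfies
`sup_{x ∈ [0,x_{1,m}]} x^ν φ_m(x)² ≤ ν^ν |p_m'(0)|^{-ν}` (with `0⁰ = 1` for `ν = 0`,
which is the convention of the real power function `Real.rpow`). -/
theorem residual_polynomial_xnu_phi_sq_bound
    {E : Type*} [NormedAddCommGroup E] [InnerProductSpace ℝ E] [CompleteSpace E]
    {ι : Type*} [Fintype ι]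
    (Λn : E →L[ℝ] E) (hsa : IsSelfAdjoint Λn) (hpos : ∀ x, 0 ≤ ⟪Λn x, x⟫)
    (κ : ℝ) (hκ : 0 < κ)
    (e : ι → E) (he : Orthonormal ℝ e) (ξ : ι → ℝ)
    (hev : ∀ i, Λn (e i) = ξ i • e i) (hξ : ∀ i, ξ i ∈ Set.Icc 0 κ)
    (r : E) (w : ι → ℝ) (hw : ∀ i, w i = ⟪e i, r⟫ ^ 2)
    (m : ℕ) (hm : 1 ≤ m) (hmγ : m ≤ cgNGamma ξ w)
    (p : Polynomial ℝ) (hdeg : p.natDegree ≤ m) (hconst : p.eval 0 = 1)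
    (hmin : ∀ q : Polynomial ℝ, q.natDegree ≤ m → q.eval 0 = 1 →
      cgIP ξ w 0 p p ≤ cgIP ξ w 0 q q)
    (x1 : ℝ) (hx1 : IsLeast {x : ℝ | p.eval x = 0} x1)
    (ν : ℝ) (hν : 0 ≤ ν) :
    ∀ x ∈ Set.Icc 0 x1,
      x ^ ν * (p.eval x * Real.sqrt (x1 / (x1 - x))) ^ 2 ≤
        ν ^ ν * |p.derivative.eval 0| ^ (-ν) := by
  intro x hx
  have hw0 : ∀ i, 0 ≤ w i := fun i => hw i ▸ sq_nonneg _
  have hsplit : p.Splits := splits_of_minimal hw0 (fun i => (hξ i).1) hmγ hdeg hconst hmin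
  have hp0 : p ≠ 0 := by
    rintro rfl
    simp at hconst
  have hroot : p.eval x1 = 0 := hx1.1
  have hx1pos : 0 < x1 := (hx.1.trans hx.2).lt_of_ne <| by
    rintro rfl
    exact one_ne_zero (hconst.symm.trans hroot)
  obtain ⟨s, hs⟩ := Multiset.exists_cons_of_mem ((mem_roots hp0).2 hroot)
  have hge : ∀ r ∈ s, x1 ≤ r := fun r hr =>
    hx1.2 ((mem_roots hp0).1 (hs ▸ Multiset.mem_cons_of_mem hr))
  have hp := hsplit.eq_prod_one_sub_inv_mul_X hconst
  rw [hs, Multiset.map_cons, Multiset.prod_cons] at hp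
  obtain ⟨h₀, hd, hnn, hle⟩ := eval_prod_one_sub_inv_mul_X_le_exp hx1pos hx s hge
  set g : ℝ[X] := (s.map fun r => 1 - C r⁻¹ * X).prod
  have hderiv : p.derivative.eval 0 = -(x1⁻¹ - g.derivative.eval 0) := by
    rw [hp]
    simp [h₀]
    ring
  have heval : p.eval x = (1 - x1⁻¹ * x) * g.eval x := by
    rw [hp]
    simp
  have hinv : 0 < x1⁻¹ := inv_pos.2 hx1pos
  have hslope : 0 < x1⁻¹ - g.derivative.eval 0 := by linarith
  rw [hderiv, abs_neg, abs_of_pos hslope]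
  refine le_trans (mul_le_mul_of_nonneg_left ?_ (Real.rpow_nonneg hx.1 ν))
    (rpow_mul_exp_neg_le hx.1 hslope hν)
  rcases hx.2.eq_or_lt with rfl | hlt
  · rw [hroot]
    simpa using Real.exp_nonneg _
  have hsub : 0 < x1 - x := sub_pos.2 hlt
  have hphi : (p.eval x * Real.sqrt (x1 / (x1 - x))) ^ 2 = (1 - x1⁻¹ * x) * g.eval x ^ 2 := by
    rw [mul_pow, Real.sq_sqrt (by positivity), heval]
    field_simp
  have hexp : 1 - x1⁻¹ * x ≤ Real.exp (-(x1⁻¹ * x)) := by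
    have := Real.add_one_le_exp (-(x1⁻¹ * x))
    linarith
  rw [hphi]
  calc (1 - x1⁻¹ * x) * g.eval x ^ 2
      ≤ Real.exp (-(x1⁻¹ * x)) * Real.exp (x * g.derivative.eval 0) ^ 2 :=
        mul_le_mul hexp (pow_le_pow_left₀ hnn hle 2) (sq_nonneg _) (Real.exp_nonneg _)
    _ = Real.exp (-(x1⁻¹ * x) + 2 * (x * g.derivative.eval 0)) := by
        rw [Real.exp_add, two_mul, Real.exp_add, sq]
    _ ≤ Real.exp (-(x * (x1⁻¹ - g.derivative.eval 0))) := by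
        rw [Real.exp_le_exp]
        have := mul_nonpos_of_nonneg_of_nonpos hx.1 hd
        linarith
end
end

section
/- For every u > 0 and every λ, δ > 0, on the event of probability at least 1 − δ where ‖(Λ + λI)^{-1/2}T^{1/2}(R̂ − Ĉ_nβ*)‖_{L²} ≤ sqrt(σ²N(λ)/(nδ)) and ‖(Λ̂_n + λI)^{-1/2}(Λ + λI)^{1/2}‖_op ≤ √2, the high-frequency part of the conjugate gradient error satisfies ‖F_u^⊥ ( q_m(Λ̂_n)T^{1/2}R̂ − Λ^α g )‖_{L²} ≤ (1/u) ‖Λ̂_n q_m(Λ̂_n)T^{1/2}R̂ − T^{1/2}R̂‖_{L²} + ((u + λ)^{1/2}/u) sqrt(2σ²N(λ)/(nδ)), where F_u^⊥ = I − F_u and F_u is the orthogonal projection onto the span of eigenfunctions of Λ̂_n with eigenvalue < u. -/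
open scoped RealInnerProductSpace BigOperators Classical
open Polynomial ContinuousLinearMap

noncomputable section

/-- The rank-one operator `x ⊗ x : y ↦ ⟪x, y⟫ x`. -/
def rankOne {E : Type*} [NormedAddCommGroup E] [InnerProductSpace ℝ E] (x : E) :
    E →L[ℝ] E :=
  (innerSL ℝ x).smulRight x

/-- The empirical covariance operator `Ĉ_n = (1/n) ∑ X_i ⊗ X_i`. -/
def empCov {E : Type*} [NormedAddCommGroup E] [InnerProductSpace ℝ E]
    (n : ℕ) (X : Fin n → E) : E →L[ℝ] E :=
  (n : ℝ)⁻¹ • ∑ i, rankOne (X i)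

/-- The empirical vector `R̂ = (1/n) ∑ Y_i X_i`. -/
def empR {E : Type*} [NormedAddCommGroup E] [InnerProductSpace ℝ E]
    (n : ℕ) (X : Fin n → E) (Y : Fin n → ℝ) : E :=
  (n : ℝ)⁻¹ • ∑ i, Y i • X i

/-- The orthogonal projection `F_u` onto the span of the eigenfunctions of `Λ̂_n`
with eigenvalue `< u`. -/
def FuOp {E : Type*} [NormedAddCommGroup E] [InnerProductSpace ℝ E]
    {N : ℕ} (e' : Fin N → E) (ξ' : Fin N → ℝ) (u : ℝ) : E →L[ℝ] E :=
  (1 : E →L[ℝ] E) - ∑ j ∈ Finset.univ.filter (fun j => u ≤ ξ' j), rankOne (e' j)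

/-- `(Λ̂_n + λI)^{-1/2}` for the finite-rank operator `Λ̂_n` given by the eigensystem
`(ξ', e')` (acting as `λ^{-1/2}` on the orthogonal complement). -/
def resHalfInv {E : Type*} [NormedAddCommGroup E] [InnerProductSpace ℝ E]
    {N : ℕ} (e' : Fin N → E) (ξ' : Fin N → ℝ) (lam : ℝ) : E →L[ℝ] E :=
  (lam ^ (-(1 / 2) : ℝ)) • ((1 : E →L[ℝ] E) - ∑ j, rankOne (e' j)) +
    ∑ j, ((ξ' j + lam) ^ (-(1 / 2) : ℝ)) • rankOne (e' j)

theorem rankOne_apply {E : Type*} [NormedAddCommGroup E] [InnerProductSpace ℝ E] (x y : E) :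
    rankOne x y = ⟪x, y⟫ • x := by
  simp [rankOne]

theorem inner_rankOne_left {E : Type*} [NormedAddCommGroup E] [InnerProductSpace ℝ E]
    (x y z : E) : ⟪rankOne x y, z⟫ = ⟪y, rankOne x z⟫ := by
  simp only [rankOne_apply, real_inner_smul_left, real_inner_smul_right]
  rw [real_inner_comm y x]
  ring

theorem inner_empCov_left {E : Type*} [NormedAddCommGroup E] [InnerProductSpace ℝ E]
    (n : ℕ) (X : Fin n → E) (x y : E) : ⟪empCov n X x, y⟫ = ⟪x, empCov n X y⟫ := by
  simp only [empCov, smul_apply, sum_apply, real_inner_smul_left, real_inner_smul_right,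
    sum_inner, inner_sum, inner_rankOne_left]

/-- The complementary projection `I - F_u` keeps the eigenfunctions with eigenvalue `≥ u`. -/
theorem one_sub_FuOp_apply {E : Type*} [NormedAddCommGroup E] [InnerProductSpace ℝ E]
    {N : ℕ} (e : Fin N → E) (ξ : Fin N → ℝ) (u : ℝ) (x : E) :
    ((1 : E →L[ℝ] E) - FuOp e ξ u) x =
      ∑ j ∈ Finset.univ.filter (fun j => u ≤ ξ j), ⟪e j, x⟫ • e j := by
  simp only [FuOp, sub_sub_cancel, sum_apply, rankOne_apply]

/-- A diagonal operator in an orthonormal family is bounded by the size of its entries. -/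
theorem Orthonormal.norm_sum_mul_inner_smul_le {E ι : Type*} [NormedAddCommGroup E]
    [InnerProductSpace ℝ E] {e : ι → E} (he : Orthonormal ℝ e) (s : Finset ι) (c : ι → ℝ)
    {K : ℝ} (hK : 0 ≤ K) (hc : ∀ j ∈ s, |c j| ≤ K) (x : E) :
    ‖∑ j ∈ s, (c j * ⟪e j, x⟫) • e j‖ ≤ K * ‖x‖ := by
  refine le_of_sq_le_sq ?_ (by positivity)
  have hsq : ‖∑ j ∈ s, (c j * ⟪e j, x⟫) • e j‖ ^ 2 = ∑ j ∈ s, (c j * ⟪e j, x⟫) ^ 2 := by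
    rw [← real_inner_self_eq_norm_sq, he.inner_sum]
    simp [sq]
  rw [hsq, mul_pow]
  calc ∑ j ∈ s, (c j * ⟪e j, x⟫) ^ 2 ≤ ∑ j ∈ s, K ^ 2 * ‖⟪e j, x⟫‖ ^ 2 := by
        refine Finset.sum_le_sum fun j hj => ?_
        rw [mul_pow, Real.norm_eq_abs, sq_abs, ← sq_abs (c j)]
        have := hc j hj
        gcongr
    _ = K ^ 2 * ∑ j ∈ s, ‖⟪e j, x⟫‖ ^ 2 := by rw [Finset.mul_sum]
    _ ≤ K ^ 2 * ‖x‖ ^ 2 := by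
        gcongr
        exact he.sum_inner_products_le x

theorem inner_resHalfInv {E : Type*} [NormedAddCommGroup E] [InnerProductSpace ℝ E]
    {N : ℕ} {e : Fin N → E} (he : Orthonormal ℝ e) (ξ : Fin N → ℝ) (lam : ℝ) (j : Fin N)
    (x : E) :
    ⟪e j, resHalfInv e ξ lam x⟫ = (ξ j + lam) ^ (-(1 / 2) : ℝ) * ⟪e j, x⟫ := by
  have hsum : ∀ c : Fin N → ℝ, ⟪e j, ∑ i, c i • e i⟫ = c j := fun c => he.inner_right_fintype c j
  simp only [resHalfInv, add_apply, smul_apply, sub_apply, one_apply_eq_self, sum_apply, rankOne_apply,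
    smul_smul, inner_add_right, real_inner_smul_right, inner_sub_right, hsum]
  ring

theorem sqrt_add_div_le_sqrt_add_div {u ξ lam : ℝ} (hu : 0 < u) (huξ : u ≤ ξ) (hlam : 0 ≤ lam) :
    √(ξ + lam) / ξ ≤ √(u + lam) / u := by
  have hξ : 0 < ξ := hu.trans_le huξ
  rw [div_le_div_iff₀ hξ hu]
  refine le_of_sq_le_sq ?_ (by positivity)
  rw [mul_pow, mul_pow, Real.sq_sqrt (by positivity), Real.sq_sqrt (by positivity)]
  have h1 : 0 ≤ (ξ - u) * (u * ξ) := mul_nonneg (sub_nonneg.2 huξ) (by positivity)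
  have h2 : 0 ≤ lam * (ξ - u) * (ξ + u) :=
    mul_nonneg (mul_nonneg hlam (sub_nonneg.2 huξ)) (by positivity)
  nlinarith

/-- If a symmetric operator `A` has eigenvectors `e j` and `A v = a + r`, the part of `v` with
eigenvalues `≥ u` is controlled by `‖a‖` and by the norm of `(A + lam)^{-1/2} r`. -/
theorem norm_one_sub_FuOp_apply_le {E : Type*} [NormedAddCommGroup E] [InnerProductSpace ℝ E]
    {N : ℕ} {e : Fin N → E} (he : Orthonormal ℝ e) {ξ : Fin N → ℝ} {A : E →L[ℝ] E}
    (hA : ∀ x y, ⟪A x, y⟫ = ⟪x, A y⟫) (hev : ∀ j, A (e j) = ξ j • e j)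
    {u lam : ℝ} (hu : 0 < u) (hlam : 0 ≤ lam) {v a r : E} (hv : A v = a + r) :
    ‖((1 : E →L[ℝ] E) - FuOp e ξ u) v‖ ≤
      (1 / u) * ‖a‖ + √(u + lam) / u * ‖resHalfInv e ξ lam r‖ := by
  set s := Finset.univ.filter (fun j => u ≤ ξ j) with hs
  have hpos : ∀ j ∈ s, u ≤ ξ j := fun j hj => (Finset.mem_filter.1 hj).2
  have hsplit : ((1 : E →L[ℝ] E) - FuOp e ξ u) v =
      ∑ j ∈ s, ((ξ j)⁻¹ * ⟪e j, a⟫) • e j +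
        ∑ j ∈ s, (√(ξ j + lam) / ξ j * ⟪e j, resHalfInv e ξ lam r⟫) • e j := by
    rw [one_sub_FuOp_apply, ← Finset.sum_add_distrib]
    refine Finset.sum_congr rfl fun j hj => ?_
    have hξ : 0 < ξ j := hu.trans_le (hpos j hj)
    have hξl : 0 < ξ j + lam := by positivity
    have hinner : ξ j * ⟪e j, v⟫ = ⟪e j, a⟫ + ⟪e j, r⟫ := by
      rw [← inner_add_right, ← hv, ← hA, hev, real_inner_smul_left]
    have hrpow : √(ξ j + lam) * (ξ j + lam) ^ (-(1 / 2) : ℝ) = 1 := by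
      rw [Real.sqrt_eq_rpow, ← Real.rpow_add hξl]
      norm_num
    rw [← add_smul, inner_resHalfInv he]
    congr 1
    have hrw : √(ξ j + lam) / ξ j * ((ξ j + lam) ^ (-(1 / 2) : ℝ) * ⟪e j, r⟫) =
        (√(ξ j + lam) * (ξ j + lam) ^ (-(1 / 2) : ℝ)) * ((ξ j)⁻¹ * ⟪e j, r⟫) := by ring
    rw [hrw, hrpow, one_mul, ← mul_add, ← hinner, inv_mul_cancel_left₀ hξ.ne']
  rw [hsplit]
  refine (norm_add_le _ _).trans (add_le_add ?_ ?_)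
  · refine he.norm_sum_mul_inner_smul_le s _ (by positivity) (fun j hj => ?_) a
    have hξ : 0 < ξ j := hu.trans_le (hpos j hj)
    rw [abs_of_pos (inv_pos.2 hξ), one_div]
    exact inv_anti₀ hu (hpos j hj)
  · refine he.norm_sum_mul_inner_smul_le s _ (by positivity) (fun j hj => ?_) _
    have hξ : 0 < ξ j := hu.trans_le (hpos j hj)
    rw [abs_of_nonneg (by positivity)]
    exact sqrt_add_div_le_sqrt_add_div hu (hpos j hj) hlam

/-- Operators that are diagonal in a Hilbert basis with inverse entries compose to the identity. -/
theorem HilbertBasis.comp_eq_one_of_diagonal {E ι : Type*} [NormedAddCommGroup E]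
    [InnerProductSpace ℝ E] (f : HilbertBasis ι ℝ E) {P Q : E →L[ℝ] E}
    {a b : ι → ℝ} (hP : ∀ i, P (f i) = a i • f i) (hQ : ∀ i, Q (f i) = b i • f i)
    (hab : ∀ i, b i * a i = 1) : P ∘L Q = 1 := by
  refine ContinuousLinearMap.ext_on (s := Set.range f) ?_ ?_
  · rw [dense_iff_closure_eq, ← Submodule.topologicalClosure_coe, f.dense_span, Submodule.top_coe]
  · rintro _ ⟨i, rfl⟩
    simp [hP, hQ, smul_smul, hab]

/-- estimation of Term-3. On the event where the empirical bound and
`‖(Λ̂_n + λI)^{-1/2}(Λ + λI)^{1/2}‖ ≤ √2` hold, for every `u > 0`,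
`‖F_u^⊥(q_m(Λ̂_n) T^{1/2}R̂ − Λ^α g)‖
  ≤ (1/u) ‖Λ̂_n q_m(Λ̂_n) T^{1/2}R̂ − T^{1/2}R̂‖ + ((u+λ)^{1/2}/u) √(2σ²N(λ)/(nδ))`. -/
theorem term_three_estimate
    {E : Type*} [NormedAddCommGroup E] [InnerProductSpace ℝ E] [CompleteSpace E]
    (n : ℕ) (hn : 0 < n) (Xs : Fin n → E) (Ys : Fin n → ℝ)
    (σ : ℝ) (δ : ℝ) (hδ : 0 < δ)
    -- `T^{1/2}`, the covariance operator `C`, `Λ = T^{1/2} C T^{1/2}`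
    (Thalf : E →L[ℝ] E) (hTsa : IsSelfAdjoint Thalf) (hTpos : ∀ x, 0 ≤ ⟪Thalf x, x⟫)
    (C : E →L[ℝ] E) (hCsa : IsSelfAdjoint C) (hCpos : ∀ x, 0 ≤ ⟪C x, x⟫)
    -- eigenbasis of `Λ`
    {ι : Type*} (f : HilbertBasis ι ℝ E) (η : ι → ℝ)
    (hev : ∀ i, (Thalf ∘L C ∘L Thalf) (f i) = η i • f i) (hη : ∀ i, 0 ≤ η i)
    (lam : ℝ) (hlam : 0 < lam)
    -- `Q = (Λ + λI)^{-1/2}` and `Phalf = (Λ + λI)^{1/2}`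
    (Q : E →L[ℝ] E) (hQsa : IsSelfAdjoint Q)
    (hQ : ∀ i, Q (f i) = ((η i + lam) ^ (-(1 / 2) : ℝ)) • f i)
    (Phalf : E →L[ℝ] E) (hPsa : IsSelfAdjoint Phalf)
    (hP : ∀ i, Phalf (f i) = ((η i + lam) ^ ((1 / 2) : ℝ)) • f i)
    -- source condition `β* = T^{1/2} Λ^α g` (so that `T^{1/2}Ĉ_n β* = Λ̂_n Λ^α g`)
    (α : ℝ) (hα : 0 < α) (g : E)
    (Λα : E →L[ℝ] E) (hΛα : ∀ i, Λα (f i) = ((η i) ^ α) • f i)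
    (βstar : E) (hβ : βstar = Thalf (Λα g))
    -- finite eigenvalue–eigenfunction system of `Λ̂_n = T^{1/2} Ĉ_n T^{1/2}`
    {N : ℕ} (e' : Fin N → E) (ξ' : Fin N → ℝ) (he' : Orthonormal ℝ e')
    (hev' : ∀ j, (Thalf ∘L empCov n Xs ∘L Thalf) (e' j) = ξ' j • e' j)
    (hker : ∀ x : E, (∀ j, ⟪e' j, x⟫ = 0) → (Thalf ∘L empCov n Xs ∘L Thalf) x = 0)
    (hξ' : ∀ j, 0 ≤ ξ' j)
    -- the conjugate gradient polynomial `q_m`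
    (m : ℕ) (hm : 1 ≤ m)
    (q : Polynomial ℝ) (hqdeg : q.natDegree ≤ m - 1)
    (hqmin : ∀ p' : Polynomial ℝ, p'.natDegree ≤ m → p'.eval 0 = 1 →
      ‖(Polynomial.aeval (Thalf ∘L empCov n Xs ∘L Thalf) (1 - Polynomial.X * q))
          (Thalf (empR n Xs Ys))‖ ≤
        ‖(Polynomial.aeval (Thalf ∘L empCov n Xs ∘L Thalf) p') (Thalf (empR n Xs Ys))‖)
    -- the event: the empirical bound and `‖(Λ̂_n + λI)^{-1/2}(Λ + λI)^{1/2}‖ ≤ √2`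
    (h1 : ‖Q (Thalf (empR n Xs Ys - empCov n Xs βstar))‖ ≤
      Real.sqrt (σ ^ 2 * (∑' i, η i / (η i + lam)) / (n * δ)))
    (h2 : ‖(resHalfInv e' ξ' lam) ∘L Phalf‖ ≤ Real.sqrt 2) :
    ∀ u : ℝ, 0 < u →
      ‖((1 : E →L[ℝ] E) - FuOp e' ξ' u)
          ((Polynomial.aeval (Thalf ∘L empCov n Xs ∘L Thalf) q)
            (Thalf (empR n Xs Ys)) - Λα g)‖ ≤
        (1 / u) * ‖(Thalf ∘L empCov n Xs ∘L Thalf)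
            ((Polynomial.aeval (Thalf ∘L empCov n Xs ∘L Thalf) q)
              (Thalf (empR n Xs Ys))) - Thalf (empR n Xs Ys)‖ +
          (Real.sqrt (u + lam) / u) *
            Real.sqrt (2 * σ ^ 2 * (∑' i, η i / (η i + lam)) / (n * δ)) := by
  intro u hu
  set A : E →L[ℝ] E := Thalf ∘L empCov n Xs ∘L Thalf with hAdef
  have hT : ∀ x y, ⟪Thalf x, y⟫ = ⟪x, Thalf y⟫ := hTsa.isSymmetric
  have hA : ∀ x y, ⟪A x, y⟫ = ⟪x, A y⟫ := fun x y => by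
    simp only [hAdef, comp_apply, hT, inner_empCov_left]
  set r : E := Thalf (empR n Xs Ys - empCov n Xs βstar) with hr
  have hPQ : Phalf ∘L Q = 1 := f.comp_eq_one_of_diagonal hP hQ fun i => by
    rw [← Real.rpow_add (by have := hη i; positivity)]
    norm_num
  have hres : ‖resHalfInv e' ξ' lam r‖ ≤
      √(2 * σ ^ 2 * (∑' i, η i / (η i + lam)) / (n * δ)) := by
    have hfactor : resHalfInv e' ξ' lam r = (resHalfInv e' ξ' lam ∘L Phalf) (Q r) := by
      have hr' : Phalf (Q r) = r := DFunLike.congr_fun hPQ r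
      rw [comp_apply, hr']
    rw [hfactor, mul_assoc 2, mul_div_assoc, Real.sqrt_mul zero_le_two]
    exact (le_opNorm _ _).trans (mul_le_mul h2 h1 (norm_nonneg _) (Real.sqrt_nonneg _))
  refine (norm_one_sub_FuOp_apply_le he' hA hev' hu hlam.le
    (a := A (aeval A q (Thalf (empR n Xs Ys))) - Thalf (empR n Xs Ys)) (r := r) ?_).trans ?_
  · rw [hr, hβ, map_sub, map_sub, hAdef]
    simp only [comp_apply]
    abel
  · gcongr
end
end
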